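/- Let ψ : A → ℂ be a right integral satisfying the strong invariance identity S((ψ ⊗ id)((c ⊗ 1) * Δ a)) = (ψ ⊗ id)(Δ(c) * (a ⊗ 1)) for all a, c ∈ A, where S is the antipode, assumed bijective. For a ∈ A define the linear functional F(a) : A → ℂ by F(a)(x) = ψ(S(x) * a), and for linear functionals f, g : A → ℂ define their convolution by (f ⋆ g)(x) = (f ⊗ g)(Δ x). Then for every linear functional f : A → ℂ and every a ∈ A, f ⋆ F(a) = F(c) where c = (id ⊗ f)(Δ a). -/

import Mathlib

open scoped TensorProduct
open TensorProduct

/-- `(φ ⊗ id)` as a map `A ⊗[ℂ] A →ₗ[ℂ] A`. -/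
noncomputable def lApply (A : Type*) [Ring A] [Algebra ℂ A] (φ : A →ₗ[ℂ] ℂ) :
    A ⊗[ℂ] A →ₗ[ℂ] A :=
  (TensorProduct.lid ℂ A).toLinearMap ∘ₗ TensorProduct.map φ LinearMap.id

/-- `(id ⊗ φ)` as a map `A ⊗[ℂ] A →ₗ[ℂ] A`. -/
noncomputable def rApply (A : Type*) [Ring A] [Algebra ℂ A] (φ : A →ₗ[ℂ] ℂ) :
    A ⊗[ℂ] A →ₗ[ℂ] A :=
  (TensorProduct.rid ℂ A).toLinearMap ∘ₗ TensorProduct.map LinearMap.id φ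

/-- A linear functional is a right integral: `(ψ ⊗ id)(Δ a) = ψ(a) • 1`. -/
def IsRightIntegral (A : Type*) [Ring A] [Bialgebra ℂ A] (ψ : A →ₗ[ℂ] ℂ) : Prop :=
  ∀ a : A, lApply A ψ (Coalgebra.comul (R := ℂ) a) = ψ a • (1 : A)

/-- `f ⊗ g` as a linear functional on `A ⊗[ℂ] A`. -/
noncomputable def tensorFunctional (A : Type*) [Ring A] [Algebra ℂ A]
    (f g : A →ₗ[ℂ] ℂ) : A ⊗[ℂ] A →ₗ[ℂ] ℂ :=
  (TensorProduct.lid ℂ ℂ).toLinearMap ∘ₗ TensorProduct.map f g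

/-- Convolution of linear functionals: `(f ⋆ g)(x) = (f ⊗ g)(Δ x)`. -/
noncomputable def convolution (A : Type*) [Ring A] [Bialgebra ℂ A]
    (f g : A →ₗ[ℂ] ℂ) : A →ₗ[ℂ] ℂ :=
  tensorFunctional A f g ∘ₗ Coalgebra.comul (R := ℂ)

/-- The Fourier-type transform `F(a)(x) = ψ(S(x) a)`. -/
noncomputable def fourierFunctional (A : Type*) [Ring A] [HopfAlgebra ℂ A]
    (ψ : A →ₗ[ℂ] ℂ) (a : A) : A →ₗ[ℂ] ℂ :=
  ψ ∘ₗ (LinearMap.mulRight ℂ a) ∘ₗ HopfAlgebra.antipode (R := ℂ)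

section AntipodeComul

open Coalgebra HopfAlgebra LinearMap WithConv

variable {R C D : Type*} [CommSemiring R] [Semiring C] [HopfAlgebra R C]

lemma AlgHom.comp_id_convMul_comp_antipode [Semiring D] [Algebra R D] (h : C →ₐ[R] D) :
    toConv h.toLinearMap * toConv (h.toLinearMap ∘ₗ antipode R (A := C)) = 1 := by
  have key := LinearMap.algHom_comp_convMul_distrib h (toConv LinearMap.id)
    (toConv (antipode R (A := C)))
  rw [LinearMap.id_mul_antipode] at key
  apply WithConv.ofConv_injective
  refine Eq.trans ?_ (key.symm.trans ?_)
  · rfl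
  · ext x
    simp

lemma AlgHom.comp_antipode_convMul_comp_id [Semiring D] [Algebra R D] (h : C →ₐ[R] D) :
    toConv (h.toLinearMap ∘ₗ antipode R (A := C)) * toConv h.toLinearMap = 1 := by
  have key := LinearMap.algHom_comp_convMul_distrib h
    (toConv (antipode R (A := C))) (toConv LinearMap.id)
  rw [LinearMap.antipode_mul_id] at key
  apply WithConv.ofConv_injective
  refine Eq.trans ?_ (key.symm.trans ?_)
  · rfl
  · ext x
    simp

/-- The antipode is an anti-homomorphism of coalgebras. -/
lemma HopfAlgebra.comul_comp_antipode :
    comul ∘ₗ antipode R (A := C) =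
      TensorProduct.map (antipode R) (antipode R) ∘ₗ
        (TensorProduct.comm R C C).toLinearMap ∘ₗ comul := by
  set i₁ : C →ₐ[R] C ⊗[R] C := Algebra.TensorProduct.includeLeft with hi₁
  set i₂ : C →ₐ[R] C ⊗[R] C := Algebra.TensorProduct.includeRight with hi₂
  have comul_eq : toConv (comul (R := R) (A := C)) =
      toConv i₁.toLinearMap * toConv i₂.toLinearMap := by
    ext x
    simp [(ℛ R x).convMul_apply, hi₁, hi₂, (ℛ R x).eq]
  have swap_eq : toConv (TensorProduct.map (antipode R) (antipode R) ∘ₗ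
        (TensorProduct.comm R C C).toLinearMap ∘ₗ comul) =
      toConv (i₂.toLinearMap ∘ₗ antipode R (A := C)) *
        toConv (i₁.toLinearMap ∘ₗ antipode R (A := C)) := by
    ext x
    rw [(ℛ R x).convMul_apply]
    simp [hi₁, hi₂, ← (ℛ R x).eq]
  apply WithConv.toConv_injective
  refine left_inv_eq_right_inv (a := toConv (comul (R := R) (A := C)))
    (AlgHom.comp_antipode_convMul_comp_id (Bialgebra.comulAlgHom R C)) ?_
  rw [comul_eq, swap_eq, mul_assoc, ← mul_assoc (toConv i₂.toLinearMap),
    AlgHom.comp_id_convMul_comp_antipode, one_mul, AlgHom.comp_id_convMul_comp_antipode]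

end AntipodeComul

theorem stmt12 (A : Type*) [Ring A] [HopfAlgebra ℂ A]
    (ψ : A →ₗ[ℂ] ℂ) (hψ : IsRightIntegral A ψ)
    (hSbij : Function.Bijective (HopfAlgebra.antipode (R := ℂ) (A := A)))
    (hstrong : ∀ a c : A,
      HopfAlgebra.antipode (R := ℂ)
          (lApply A ψ ((c ⊗ₜ[ℂ] (1 : A)) * Coalgebra.comul (R := ℂ) a)) =
        lApply A ψ (Coalgebra.comul (R := ℂ) c * (a ⊗ₜ[ℂ] (1 : A)))) :
    ∀ (f : A →ₗ[ℂ] ℂ) (a : A),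
      convolution A f (fourierFunctional A ψ a) =
        fourierFunctional A ψ (rApply A f (Coalgebra.comul (R := ℂ) a)) := by
  intro f a
  ext x
  have rx := Coalgebra.Repr.arbitrary ℂ x
  have ra := Coalgebra.Repr.arbitrary ℂ a
  have hx : Coalgebra.comul (R := ℂ) (HopfAlgebra.antipode ℂ x) =
      ∑ i ∈ rx.index, HopfAlgebra.antipode ℂ (rx.right i) ⊗ₜ[ℂ]
        HopfAlgebra.antipode ℂ (rx.left i) := by
    refine (LinearMap.congr_fun HopfAlgebra.comul_comp_antipode x).trans ?_
    simp [← rx.eq]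
  have key : lApply A ψ ((HopfAlgebra.antipode ℂ x ⊗ₜ[ℂ] (1 : A)) *
      Coalgebra.comul (R := ℂ) a) =
      ∑ i ∈ rx.index,
        ψ (HopfAlgebra.antipode ℂ (rx.right i) * a) • rx.left i := by
    apply hSbij.injective
    rw [hstrong, hx]
    simp [lApply, Finset.sum_mul]
  have hf := congrArg f key
  simp only [← ra.eq] at hf
  simp only [convolution, fourierFunctional, tensorFunctional, rApply, LinearMap.comp_apply,
    ← rx.eq, ← ra.eq]
  simp [lApply, Finset.mul_sum] at hf ⊢
  simpa [mul_comm] using hf.symm
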